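/- The endomorphism ring of the Prüfer module U over K[x,x⁻¹] is isomorphic, as a ring, to the ring K[[t]] of formal power series in one variable over K. -/

import Mathlib

/-- The transition map `ψ_{i,ℓ} : R/Ra^i → R/Ra^ℓ`, `r + Ra^i ↦ r·a^{ℓ-i} + Ra^ℓ`. -/
def psi {R : Type*} [Ring R] (a : R) (i ℓ : ℕ) (h : i ≤ ℓ) :
    (R ⧸ Submodule.span R {a ^ i}) →ₗ[R] (R ⧸ Submodule.span R {a ^ ℓ}) :=
  Submodule.liftQ _
    ((Submodule.span R {a ^ ℓ}).mkQ ∘ₗ LinearMap.toSpanSingleton R R (a ^ (ℓ - i)))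
    (by
      rw [Submodule.span_le]
      rintro x hx
      rw [Set.mem_singleton_iff] at hx
      subst hx
      simp only [SetLike.mem_coe, LinearMap.mem_ker, LinearMap.comp_apply,
        LinearMap.toSpanSingleton_apply, Submodule.mkQ_apply,
        Submodule.Quotient.mk_eq_zero, smul_eq_mul]
      rw [← pow_add, Nat.add_sub_cancel' h]
      exact Submodule.mem_span_singleton_self _)

/-- The Prüfer module `U` over `K[x,x⁻¹]`: the direct limit of the modules
`M_n = K[x,x⁻¹]/((x−1)^n)`, `n ≥ 1`, with transition maps sending `r + ((x−1)^i)` to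
`r(x−1)^{ℓ−i} + ((x−1)^ℓ)`, realized as the direct limit over `n : ℕ` of `M_{n+1}`.
(Here `x = T 1`.) -/
noncomputable abbrev laurentPruefer (K : Type*) [Field K] : Type _ :=
  Module.DirectLimit
    (fun n : ℕ => LaurentPolynomial K ⧸
      Submodule.span (LaurentPolynomial K) {(LaurentPolynomial.T 1 - 1) ^ (n + 1)})
    (fun i j h => psi (LaurentPolynomial.T 1 - 1) (i + 1) (j + 1) (Nat.succ_le_succ h))

theorem abs_iso {R S U : Type*} [CommRing R] [IsDomain R] [CommRing S] [AddCommGroup U] [Module R U]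
    (a : R) (ha : a ≠ 0) (X : S) (φ : R →+* S) (hφ : φ a = X)
    (u : ℕ → U) (h1 : ∀ n, a • u (n+1) = u n) (h2 : ∀ n r, r • u n = 0 ↔ a^(n+1) ∣ r)
    (h3 : ∀ v, ∃ (n : ℕ) (r : R), v = r • u n)
    (h4 : ∀ (f : S) (n : ℕ), ∃ r, X^n ∣ f - φ r)
    (h5 : ∀ n r, X^n ∣ φ r → a^n ∣ r)
    (hsep : ∀ f : S, (∀ n, X^(n+1) ∣ f) → f = 0)
    (hcomp : ∀ r : ℕ → S, (∀ n, X^(n+1) ∣ r (n+1) - r n) → ∃ f, ∀ n, X^(n+1) ∣ f - r n) :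
    Nonempty (Module.End R U ≃+* S) := by
  have hshift : ∀ k n, a^k • u (n+k) = u n := by
    intro k
    induction k with
    | zero => intro n; simp
    | succ k ih => intro n; rw [pow_succ, mul_smul, ← add_assoc, h1, ih]
  have hkill : ∀ n, a^(n+1) • u n = 0 := fun n => (h2 n _).2 dvd_rfl
  have hmono : ∀ (v : U) n m, n ≤ m → a^n • v = 0 → a^m • v = 0 := by
    intro v n m h hv
    obtain ⟨k, rfl⟩ := Nat.exists_eq_add_of_le h
    rw [add_comm, pow_add, mul_smul, hv, smul_zero]
  have htor : ∀ v : U, ∃ n, a^n • v = 0 := by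
    intro v
    obtain ⟨n, r, rfl⟩ := h3 v
    exact ⟨n+1, by rw [smul_comm, hkill, smul_zero]⟩
  have hdv : ∀ (v : U) n r, a^n • v = 0 → a^n ∣ r → r • v = 0 := by
    rintro v n r hv ⟨c, rfl⟩
    rw [mul_comm, mul_smul, hv, smul_zero]
  choose N hN using htor
  choose P hP using h4
  -- key
  have key : ∀ (f : S) (v : U) n r, a^n • v = 0 → X^n ∣ f - φ r → P f (N v) • v = r • v := by
    intro f v n r hv hr
    rw [← sub_eq_zero, ← sub_smul]
    have hm : a^(min n (N v)) • v = 0 := by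
      rcases le_total n (N v) with h | h
      · rwa [min_eq_left h]
      · rw [min_eq_right h]; exact hN v
    refine hdv v _ _ hm (h5 _ _ ?_)
    have e : φ (P f (N v) - r) = (f - φ r) - (f - φ (P f (N v))) := by rw [map_sub]; ring
    rw [e]
    exact dvd_sub ((pow_dvd_pow X (min_le_left _ _)).trans hr)
      ((pow_dvd_pow X (min_le_right _ _)).trans (hP f (N v)))
  have key2 : ∀ (f : S) (v : U) n, a^n • v = 0 → P f (N v) • v = P f n • v :=
    fun f v n hv => key f v n _ hv (hP f n)
  let A : S → Module.End R U := fun f =>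
    { toFun := fun v => P f (N v) • v
      map_add' := by
        intro v w
        have hv := hmono v _ _ (le_max_left (N v) (N w)) (hN v)
        have hw := hmono w _ _ (le_max_right (N v) (N w)) (hN w)
        rw [key2 f v _ hv, key2 f w _ hw, key2 f (v+w) (max (N v) (N w)) (by rw [smul_add, hv, hw, add_zero]), smul_add]
      map_smul' := by
        intro c v
        rw [key2 f (c • v) (N v) (by rw [smul_comm, hN, smul_zero]), smul_comm]; rfl }
  have hA : ∀ (f : S) (v : U) n r, a^n • v = 0 → X^n ∣ f - φ r → A f v = r • v := key
  let F : S →+* Module.End R U :=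
    { toFun := A
      map_one' := by
        ext v
        rw [hA 1 v (N v) 1 (hN v) (by simp)]; simp
      map_zero' := by
        ext v
        rw [hA 0 v (N v) 0 (hN v) (by simp)]; simp
      map_add' := by
        intro f g
        ext v
        rw [hA (f+g) v (N v) (P f (N v) + P g (N v)) (hN v) ?_, add_smul]
        · rfl
        · have := dvd_add (hP f (N v)) (hP g (N v))
          rw [map_add]; convert this using 1; ring
      map_mul' := by
        intro f g
        ext v
        rw [hA (f*g) v (N v) (P f (N v) * P g (N v)) (hN v) ?_, Module.End.mul_apply, mul_smul]
        · rw [hA g v (N v) _ (hN v) (hP g _), map_smul, hA f v (N v) _ (hN v) (hP f _), smul_comm]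
        · have e : f * g - φ (P f (N v) * P g (N v)) =
              (f - φ (P f (N v))) * g + φ (P f (N v)) * (g - φ (P g (N v))) := by
            rw [map_mul]; ring
          rw [e]
          exact dvd_add ((hP f _).mul_right _) ((hP g _).mul_left _) }
  have hF : ∀ (f : S) (v : U) n r, a^n • v = 0 → X^n ∣ f - φ r → F f v = r • v := key
  have hinj : Function.Injective F := by
    rw [injective_iff_map_eq_zero]
    intro f hf
    refine hsep f fun n => ?_
    have h := hF f (u n) (n+1) _ (hkill n) (hP f (n+1))
    rw [hf, LinearMap.zero_apply, eq_comm, h2] at h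
    have h' := map_dvd φ h
    rw [map_pow, hφ] at h'
    exact (dvd_sub_left h').1 (hP f (n+1))
  have hann : ∀ (v : U) n, a^(n+1) • v = 0 → ∃ r : R, v = r • u n := by
    intro v n hv
    obtain ⟨m, s, rfl⟩ := h3 v
    have e : s • u m = (s * a^n) • u (m+n) := by rw [mul_smul, hshift]
    rw [e, smul_smul, h2] at hv
    have : a^m ∣ s * a^n := by
      have h : a^(n+1) * a^m ∣ a^(n+1) * (s * a^n) := by
        rw [← pow_add]; convert hv using 2; ring
      exact (mul_dvd_mul_iff_left (pow_ne_zero _ ha)).1 h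
    obtain ⟨c, hc⟩ := this
    refine ⟨c, ?_⟩
    rw [e, hc, mul_comm, mul_smul, add_comm m n, hshift]
  have hsurj : Function.Surjective F := by
    intro g
    have : ∀ n, ∃ r, g (u n) = r • u n := fun n =>
      hann _ n (by rw [← map_smul, hkill, map_zero])
    choose r hr using this
    obtain ⟨f, hf⟩ := hcomp (fun n => φ (r n)) (by
      intro n
      have : (r (n+1) - r n) • u n = 0 := by
        rw [sub_smul, ← hr n, ← h1 n, map_smul, hr (n+1), smul_comm, sub_self]
      rw [h2] at this
      have h' := map_dvd φ this
      rwa [map_pow, hφ, map_sub] at h')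
    refine ⟨f, ?_⟩
    ext v
    obtain ⟨n, s, rfl⟩ := h3 v
    rw [map_smul, map_smul, hr, hF f (u n) (n+1) _ (hkill n) (hf n)]
  exact ⟨(RingEquiv.ofBijective F ⟨hinj, hsurj⟩).symm⟩

theorem psi_mk {R : Type*} [Ring R] (a : R) (i l : ℕ) (h : i ≤ l) (r : R) :
    psi a i l h (Submodule.Quotient.mk r) = Submodule.Quotient.mk (r * a ^ (l - i)) := rfl

theorem psi_directed {R : Type*} [CommRing R] (a : R) :
    DirectedSystem (fun n : ℕ => R ⧸ Submodule.span R {a ^ (n + 1)})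
      (fun i j h => psi a (i + 1) (j + 1) (Nat.succ_le_succ h)) where
  map_self := by
    intro i x
    obtain ⟨r, rfl⟩ := Submodule.Quotient.mk_surjective _ x
    rw [psi_mk]; simp
  map_map := by
    intro k j i h1 h2 x
    obtain ⟨r, rfl⟩ := Submodule.Quotient.mk_surjective _ x
    rw [psi_mk, psi_mk, psi_mk, mul_assoc, ← pow_add]
    congr 3
    omega

theorem laurent_phi (K : Type*) [Field K] :
    ∃ φ : LaurentPolynomial K →+* PowerSeries K,
      φ (LaurentPolynomial.T 1 - 1) = PowerSeries.X ∧
      (∀ (f : PowerSeries K) (n : ℕ), ∃ r, PowerSeries.X ^ n ∣ f - φ r) ∧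
      (∀ n r, PowerSeries.X ^ n ∣ φ r → (LaurentPolynomial.T 1 - 1) ^ n ∣ r) := by
  have hu : IsUnit (1 + PowerSeries.X : PowerSeries K) := by
    rw [PowerSeries.isUnit_iff_constantCoeff]; simp
  obtain ⟨w, hw⟩ := hu
  have hφ : LaurentPolynomial.eval₂ (PowerSeries.C (R := K)) w (LaurentPolynomial.T 1 - 1) =
      PowerSeries.X := by
    have := LaurentPolynomial.eval₂_T_n (PowerSeries.C (R := K)) w 1
    rw [Nat.cast_one] at this
    rw [map_sub, map_one, this, pow_one, hw]; ring
  refine ⟨LaurentPolynomial.eval₂ (PowerSeries.C (R := K)) w, hφ, ?_, ?_⟩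
  · intro f n
    refine ⟨(PowerSeries.trunc n f).eval₂ LaurentPolynomial.C (LaurentPolynomial.T 1 - 1), ?_⟩
    rw [Polynomial.hom_eval₂, hφ]
    have e : (LaurentPolynomial.eval₂ (PowerSeries.C (R := K)) w).comp LaurentPolynomial.C
        = PowerSeries.C (R := K) := by
      ext1 k; simp
    rw [e, Polynomial.eval₂_C_X_eq_coe]
    exact ⟨_, sub_eq_iff_eq_add.2 (PowerSeries.eq_X_pow_mul_shift_add_trunc n f)⟩
  · have one : ∀ r, PowerSeries.X ∣ LaurentPolynomial.eval₂ (PowerSeries.C (R := K)) w r →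
        (LaurentPolynomial.T 1 - 1) ∣ r := by
      intro r hr
      obtain ⟨n, p, hp⟩ := LaurentPolynomial.exists_T_pow r
      have h1 : PowerSeries.X ∣ Polynomial.eval₂ (PowerSeries.C (R := K)) w p := by
        rw [← LaurentPolynomial.eval₂_toLaurent, hp, map_mul]
        exact hr.mul_right _
      rw [PowerSeries.X_dvd_iff, Polynomial.hom_eval₂, hw] at h1
      have e : (PowerSeries.constantCoeff (R := K)).comp (PowerSeries.C (R := K))
        = RingHom.id K := by ext1 k; simp
      rw [e] at h1
      simp only [map_add, map_one, PowerSeries.constantCoeff_X, add_zero,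
        Polynomial.eval₂_id] at h1
      obtain ⟨q, rfl⟩ := Polynomial.dvd_iff_isRoot.2 h1
      refine ⟨Polynomial.toLaurent q * LaurentPolynomial.T (-n), ?_⟩
      have : r = r * LaurentPolynomial.T n * LaurentPolynomial.T (-n) := by
        rw [mul_assoc, ← LaurentPolynomial.T_add]; simp
      rw [this, ← hp]
      simp [mul_assoc]
    intro n
    induction n with
    | zero => intro r _; simp
    | succ n ih =>
      intro r hr
      obtain ⟨s, rfl⟩ := one r ((dvd_pow_self _ (Nat.succ_ne_zero n)).trans hr)
      rw [map_mul, hφ, pow_succ'] at hr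
      rw [pow_succ']
      exact mul_dvd_mul_left _ (ih s ((mul_dvd_mul_iff_left PowerSeries.X_ne_zero).1 hr))

/-- The endomorphism ring of the Prüfer module `U` over `K[x,x⁻¹]` is
isomorphic, as a ring, to the ring `K[[t]]` of formal power series in one variable over
`K`. -/
theorem stmt_18 {K : Type*} [Field K] :
    Nonempty
      (Module.End (LaurentPolynomial K) (laurentPruefer K) ≃+* PowerSeries K) := by
  let a : LaurentPolynomial K := LaurentPolynomial.T 1 - 1
  obtain ⟨φ, hφ, h4, h5⟩ := laurent_phi K
  haveI := psi_directed a
  have ha : a ≠ 0 := by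
    intro h
    have : φ a = 0 := by rw [h, map_zero]
    rw [hφ] at this
    exact PowerSeries.X_ne_zero this
  let u : ℕ → laurentPruefer K := fun n =>
    Module.DirectLimit.of (LaurentPolynomial K) ℕ _ _ n (Submodule.Quotient.mk 1)
  have hru : ∀ n (r : LaurentPolynomial K), r • u n =
      Module.DirectLimit.of (LaurentPolynomial K) ℕ _ _ n (Submodule.Quotient.mk r) := by
    intro n r
    simp only [u]
    rw [← map_smul, ← Submodule.Quotient.mk_smul, smul_eq_mul, mul_one]
  refine abs_iso a ha PowerSeries.X φ hφ u ?_ ?_ ?_ h4 h5 ?_ ?_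
  · intro n
    rw [hru]
    simp only [u]
    rw [← Module.DirectLimit.of_f (hij := Nat.le_succ n), psi_mk]
    simp [a]
  · intro n r
    rw [hru]
    constructor
    · intro h
      obtain ⟨j, hj, h⟩ := Module.DirectLimit.of.zero_exact h
      rw [psi_mk, Submodule.Quotient.mk_eq_zero, Submodule.mem_span_singleton] at h
      obtain ⟨c, hc⟩ := h
      have h : a ^ (j - n) * a ^ (n+1) ∣ a ^ (j - n) * r := by
        refine ⟨c, ?_⟩
        rw [← pow_add, show j - n + (n + 1) = j + 1 by omega, mul_comm (a ^ (j+1))]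
        rw [Nat.add_sub_add_right] at hc
        rw [mul_comm]
        exact hc.symm
      exact (mul_dvd_mul_iff_left (pow_ne_zero _ ha)).1 h
    · rintro ⟨c, rfl⟩
      have : (Submodule.Quotient.mk (a ^ (n+1) * c) : LaurentPolynomial K ⧸
          Submodule.span (LaurentPolynomial K) {a ^ (n + 1)}) = 0 := by
        rw [Submodule.Quotient.mk_eq_zero, Submodule.mem_span_singleton]
        exact ⟨c, by rw [smul_eq_mul, mul_comm]⟩
      rw [this, map_zero]
  · intro v
    obtain ⟨n, x, rfl⟩ := Module.DirectLimit.exists_of v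
    obtain ⟨r, rfl⟩ := Submodule.Quotient.mk_surjective _ x
    exact ⟨n, r, (hru n r).symm⟩
  · intro f hf
    ext n
    exact PowerSeries.X_pow_dvd_iff.1 (hf n) n (Nat.lt_succ_self n)
  · intro r hr
    refine ⟨PowerSeries.mk fun n => PowerSeries.coeff n (r n), fun n => ?_⟩
    rw [PowerSeries.X_pow_dvd_iff]
    intro m hm
    rw [map_sub, PowerSeries.coeff_mk, sub_eq_zero]
    have hm' : m ≤ n := Nat.lt_succ_iff.1 hm
    clear hm
    induction n, hm' using Nat.le_induction with
    | base => rfl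
    | succ n hn ih =>
      rw [ih]
      have := PowerSeries.X_pow_dvd_iff.1 (hr n) m (by omega)
      rw [map_sub, sub_eq_zero] at this
      exact this.symm
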